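/- Let (v̂_k)_{k ≥ 0} be the sequence of functions on [0,1] determined by v̂_0(s) = 0 for all s ∈ [0,1] and the recursion v̂_k(s) = (1 − ĥ_k(s) + s) v̂_{k-1}(s) + ∫_s^{ĥ_k(s)} (1 + v̂_{k-1}(x)) dx for k ≥ 1, where ĥ_k(s) = min{ s + (2(1-s)/k)^{1/2}, 1 }. Then for all k ≥ 1 and all s ∈ [0,1], v̂_k(s) ≤ (2k(1-s))^{1/2}. -/

import Mathlib

open MeasureTheory intervalIntegral

/-- The adaptive threshold `ĥ_k(s) = min{ s + (2(1-s)/k)^{1/2}, 1 }`. -/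
noncomputable def hhat (k : ℕ) (s : ℝ) : ℝ :=
  min (s + Real.sqrt (2 * (1 - s) / k)) 1

/-- Closed form of the integral of `√(1 - x)`. -/
lemma integral_sqrt_one_sub (s t : ℝ) (hs : s ≤ 1) (ht : t ≤ 1) :
    ∫ x in s..t, √(1 - x) =
      2 / 3 * ((1 - s) * √(1 - s) - (1 - t) * √(1 - t)) := by
  have key : ∀ y : ℝ, 0 ≤ y → y ^ ((1:ℝ) / 2 + 1) = y * √y := by
    intro y hy
    rw [Real.rpow_add' hy (by norm_num), Real.rpow_one, ← Real.sqrt_eq_rpow, mul_comm]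
  rw [intervalIntegral.integral_comp_sub_left (fun y => √y) 1]
  simp_rw [Real.sqrt_eq_rpow]
  rw [integral_rpow (Or.inl (by norm_num)), ← Real.sqrt_eq_rpow, ← Real.sqrt_eq_rpow,
    key _ (by linarith), key _ (by linarith)]
  ring

lemma sq_add_sq_sub_le {a b : ℝ} (hb : 0 ≤ b) (hab : b ≤ a) (ha : a ≤ 1) :
    2 * (a - 1 / 3 * ((a - b) ^ 2 * (a + 2 * b))) ^ 2 + (a ^ 2 - b ^ 2) ^ 2 ≤ 2 * a ^ 2 := by
  have h0 : 0 ≤ a := hb.trans hab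
  have h1 : (a - b) * (a + 2 * b) ^ 2 ≤ a + 3 * b := by
    have h2 : a ^ 2 * (a + 3 * b) ≤ 1 * (a + 3 * b) :=
      mul_le_mul_of_nonneg_right (by nlinarith) (by positivity)
    nlinarith [pow_nonneg hb 3]
  have h3 : 0 ≤ (a - b) ^ 3 := pow_nonneg (sub_nonneg.2 hab) 3
  have h4 : 0 ≤ (a - b) ^ 3 * (a + 3 * b - (a - b) * (a + 2 * b) ^ 2) :=
    mul_nonneg h3 (sub_nonneg.2 h1)
  have h5 : 0 ≤ (a - b) ^ 3 * (a + 3 * b) := mul_nonneg h3 (by positivity)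
  nlinarith

/-- The one-step inequality when the threshold lies below `1`, with `a = √(1 - s)` and
`b = √(1 - h)`. -/
lemma step_le_of_interior {a b c k : ℝ} (hb : 0 ≤ b) (hab : b ≤ a) (ha : a ≤ 1) (hk : 1 ≤ k)
    (hc2 : c ^ 2 = 2 * (k - 1)) (hd : (a ^ 2 - b ^ 2) ^ 2 * k = 2 * a ^ 2) :
    (1 - (a ^ 2 - b ^ 2)) * (c * a) + (a ^ 2 - b ^ 2) + c * (2 / 3 * (a ^ 3 - b ^ 3)) ≤
      k * (a ^ 2 - b ^ 2) := by
  have hE := sq_add_sq_sub_le hb hab ha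
  have hd0 : 0 ≤ a ^ 2 - b ^ 2 := by nlinarith
  have : c * (a - 1 / 3 * ((a - b) ^ 2 * (a + 2 * b))) ≤ (k - 1) * (a ^ 2 - b ^ 2) := by
    refine le_of_sq_le_sq ?_ (mul_nonneg (by linarith) hd0)
    rw [mul_pow, hc2, mul_pow]
    have := mul_le_mul_of_nonneg_left hE (sub_nonneg.2 hk)
    have e : (k - 1) ^ 2 * (a ^ 2 - b ^ 2) ^ 2 = (k - 1) * (2 * a ^ 2 - (a ^ 2 - b ^ 2) ^ 2) := by
      rw [← hd]; ring
    rw [e]; linarith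
  linarith

/-- The one-step inequality when the threshold is `1`, with `a = √(1 - s)`. -/
lemma step_le_of_boundary {a c q : ℝ} (ha0 : 0 ≤ a) (ha : a ≤ 1) (hc : 0 ≤ c) (hq : 0 ≤ q)
    (hcq : q ^ 2 = c ^ 2 + 2) (hc2 : c = 0 ∨ 2 ≤ c ^ 2) :
    (1 - a ^ 2) * (c * a) + a ^ 2 + c * (2 / 3 * a ^ 3) ≤ q * a := by
  have : c * (1 - a ^ 2 / 3) + a ≤ q := by
    rcases hc2 with rfl | h
    · nlinarith
    · have hcpos : 0 < c := by nlinarith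
      have h1 : 3 * q ≤ 5 * c := by nlinarith
      have h2 : (q - c) * (q + c) = 2 := by linarith
      have h3 : 3 ≤ 4 * c * (q - c) := by nlinarith
      have h4 : 0 ≤ (2 * c * a - 3) ^ 2 := sq_nonneg _
      have h5 : 4 * c * (c * (1 - a ^ 2 / 3) + a) ≤ 4 * c * q := by nlinarith
      exact le_of_mul_le_mul_left h5 (by positivity)
  nlinarith [mul_le_mul_of_nonneg_right this ha0]

lemma le_hhat (k : ℕ) {s : ℝ} (hs : s ≤ 1) : s ≤ hhat k s :=
  le_min (le_add_of_nonneg_right (Real.sqrt_nonneg _)) hs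

lemma hhat_le_one (k : ℕ) (s : ℝ) : hhat k s ≤ 1 := min_le_right _ _

lemma continuous_hhat (k : ℕ) : Continuous (hhat k) := by
  unfold hhat
  fun_prop

lemma hhat_step_le (n : ℕ) {s : ℝ} (hs0 : 0 ≤ s) (hs1 : s ≤ 1) :
    (1 - hhat (n + 1) s + s) * √(2 * n * (1 - s)) + (hhat (n + 1) s - s) +
      √(2 * n) * (2 / 3 * ((1 - s) * √(1 - s) -
        (1 - hhat (n + 1) s) * √(1 - hhat (n + 1) s))) ≤
      √(2 * (n + 1 : ℕ) * (1 - s)) := by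
  have hle := le_hhat (n + 1) hs1
  have hle1 := hhat_le_one (n + 1) s
  have hh : hhat (n + 1) s = s + √(2 * (1 - s) / (n + 1 : ℕ)) ∨ hhat (n + 1) s = 1 :=
    min_choice _ _
  generalize hhat (n + 1) s = h at *
  have hn : (0:ℝ) ≤ n := n.cast_nonneg
  have ha2 := Real.sq_sqrt (sub_nonneg.2 hs1)
  have hb2 := Real.sq_sqrt (sub_nonneg.2 hle1)
  have ha0 := Real.sqrt_nonneg (1 - s)
  have hb0 := Real.sqrt_nonneg (1 - h)
  have hab : √(1 - h) ≤ √(1 - s) := Real.sqrt_le_sqrt (by linarith)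
  have ha1 : √(1 - s) ≤ 1 := Real.sqrt_le_one.2 (by linarith)
  have hc2 := Real.sq_sqrt (show (0:ℝ) ≤ 2 * n by positivity)
  have hc0 := Real.sqrt_nonneg (2 * (n:ℝ))
  rw [Real.sqrt_mul (show (0:ℝ) ≤ 2 * n by positivity)]
  set a := √(1 - s)
  set b := √(1 - h)
  set c := √(2 * (n:ℝ))
  have hs : s = 1 - a ^ 2 := by linarith
  have hh' : h = 1 - b ^ 2 := by linarith
  rcases hh with hh | hh
  · have hd : (a ^ 2 - b ^ 2) ^ 2 * ((n:ℝ) + 1) = 2 * a ^ 2 := by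
      have e : a ^ 2 - b ^ 2 = √(2 * (1 - s) / (n + 1 : ℕ)) := by linarith
      rw [e, Real.sq_sqrt (by rw [← ha2]; positivity), ha2]
      push_cast
      field_simp
    have key := step_le_of_interior (c := c) hb0 hab ha1 (by linarith) (by linarith) hd
    have hrhs : ((n:ℝ) + 1) * (a ^ 2 - b ^ 2) ≤ √(2 * (n + 1 : ℕ) * (1 - s)) := by
      apply Real.le_sqrt_of_sq_le
      rw [mul_pow, ← ha2]
      push_cast
      nlinarith
    refine le_trans (le_of_eq ?_) (key.trans hrhs)
    rw [← ha2, ← hb2, hs, hh']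
    ring
  · have hb : b = 0 := by
      have : b ^ 2 = 0 := by linarith
      simpa using this
    have hq2 := Real.sq_sqrt (show (0:ℝ) ≤ 2 * (n + 1 : ℕ) by positivity)
    rw [Real.sqrt_mul (show (0:ℝ) ≤ 2 * (n + 1 : ℕ) by positivity)]
    have hcn : c = 0 ∨ 2 ≤ c ^ 2 := by
      rcases Nat.eq_zero_or_pos n with h0 | h0
      · left; simp [c, h0]
      · right
        rw [hc2]
        have : (1:ℝ) ≤ n := by exact_mod_cast h0
        linarith
    have key := step_le_of_boundary ha0 ha1 hc0 (Real.sqrt_nonneg (2 * ((n + 1 : ℕ) : ℝ)))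
      (by rw [hq2, hc2]; push_cast; ring) hcn
    refine le_trans (le_of_eq ?_) key
    rw [hb, ← ha2, hs, hh]
    ring

/-- On `[0,1]`, each value function agrees with a continuous function on `ℝ` that satisfies the
square-root bound. -/
lemma exists_continuous_eqOn_le (v : ℕ → ℝ → ℝ)
    (hv0 : ∀ s ∈ Set.Icc (0:ℝ) 1, v 0 s = 0)
    (hv : ∀ k : ℕ, 1 ≤ k → ∀ s ∈ Set.Icc (0:ℝ) 1,
      v k s = (1 - hhat k s + s) * v (k-1) s + ∫ x in s..(hhat k s), (1 + v (k-1) x)) (k : ℕ) :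
    ∃ w : ℝ → ℝ, Continuous w ∧ Set.EqOn (v k) w (Set.Icc 0 1) ∧
      ∀ s ∈ Set.Icc (0:ℝ) 1, w s ≤ √(2 * k * (1 - s)) := by
  induction k with
  | zero => exact ⟨fun _ => 0, continuous_const, hv0, fun s _ => Real.sqrt_nonneg _⟩
  | succ n ih =>
    obtain ⟨w, hwc, hvw, hw⟩ := ih
    have hwi : ∀ a b : ℝ, IntervalIntegrable (fun x => 1 + w x) volume a b :=
      fun a b => (continuous_const.add hwc).intervalIntegrable a b
    have hh := continuous_hhat (n + 1)
    refine ⟨fun s => (1 - hhat (n + 1) s + s) * w s + ∫ x in s..(hhat (n + 1) s), (1 + w x),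
      ?_, ?_, ?_⟩
    · have hP : Continuous fun t => ∫ x in (0:ℝ)..t, (1 + w x) :=
        intervalIntegral.continuous_primitive hwi 0
      have e : ∀ s, ∫ x in s..(hhat (n + 1) s), (1 + w x) =
          (∫ x in (0:ℝ)..(hhat (n + 1) s), (1 + w x)) - ∫ x in (0:ℝ)..s, (1 + w x) :=
        fun s => (intervalIntegral.integral_interval_sub_left (hwi _ _) (hwi _ _)).symm
      simp_rw [e]
      exact (((continuous_const.sub hh).add continuous_id).mul hwc).add ((hP.comp hh).sub hP)
    · intro s hs
      have hle := le_hhat (n + 1) hs.2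
      simp only [hv (n + 1) (by omega) s hs, Nat.add_sub_cancel, hvw hs]
      congr 1
      refine intervalIntegral.integral_congr fun x hx => ?_
      rw [Set.uIcc_of_le hle] at hx
      simp only [hvw ⟨hs.1.trans hx.1, hx.2.trans (hhat_le_one _ _)⟩]
    · intro s hs
      have hle := le_hhat (n + 1) hs.2
      have hle1 := hhat_le_one (n + 1) s
      refine le_trans ?_ (hhat_step_le n hs.1 hs.2)
      have hcont : Continuous fun x : ℝ => √(2 * (n:ℝ)) * √(1 - x) := by fun_prop
      have hint : ∫ x in s..(hhat (n + 1) s), (1 + w x) ≤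
          ∫ x in s..(hhat (n + 1) s), (1 + √(2 * (n:ℝ)) * √(1 - x)) := by
        refine intervalIntegral.integral_mono_on hle (hwi _ _)
          ((continuous_const.add hcont).intervalIntegrable _ _) fun x hx => ?_
        have := hw x ⟨hs.1.trans hx.1, hx.2.trans hle1⟩
        rw [Real.sqrt_mul (by positivity)] at this
        linarith
      rw [intervalIntegral.integral_add (continuous_const.intervalIntegrable _ _)
        (hcont.intervalIntegrable _ _), intervalIntegral.integral_const_mul,
        integral_sqrt_one_sub _ _ hs.2 hle1] at hint
      have hmul := mul_le_mul_of_nonneg_left (hw s hs)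
        (show 0 ≤ 1 - hhat (n + 1) s + s by linarith [hs.1])
      simp only [intervalIntegral.integral_const, smul_eq_mul, mul_one] at hint
      linarith

/-- the value functions `v̂_k`, determined by `v̂_0 ≡ 0` and the recursion
`v̂_k(s) = (1 − ĥ_k(s) + s) v̂_{k-1}(s) + ∫_s^{ĥ_k(s)} (1 + v̂_{k-1}(x)) dx`, satisfy
`v̂_k(s) ≤ (2k(1-s))^{1/2}` for all `k ≥ 1` and `s ∈ [0,1]`. -/
theorem stmt_2 (v : ℕ → ℝ → ℝ)
    (hv0 : ∀ s ∈ Set.Icc (0:ℝ) 1, v 0 s = 0)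
    (hv : ∀ k : ℕ, 1 ≤ k → ∀ s ∈ Set.Icc (0:ℝ) 1,
      v k s = (1 - hhat k s + s) * v (k-1) s + ∫ x in s..(hhat k s), (1 + v (k-1) x)) :
    ∀ k : ℕ, 1 ≤ k → ∀ s ∈ Set.Icc (0:ℝ) 1,
      v k s ≤ Real.sqrt (2 * k * (1 - s)) := by
  intro k _ s hs
  obtain ⟨w, -, hvw, hw⟩ := exists_continuous_eqOn_le v hv0 hv k
  exact (hvw hs).trans_le (hw s hs)
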